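/- Let m ≥ 18 and n ≥ m² − m + 1. Let U be a connected graph with n vertices and exactly n edges that is not a cycle, let t_1t_2 be an edge of the unique cycle of U such that t_1 is not a leaf of the tree T = U − t_1t_2, and let T denote this tree. Let G be a graph on 2n − 1 vertices that does not contain the fan F_m as a subgraph and whose complement does not contain U as a subgraph, and suppose U_1 and U_2 are disjoint independent sets of G, each of size at least n − 2m + 2. Then every vertex of T is adjacent in T to at most 2m − 2 leaves of T, and the maximum degree of T satisfies Δ(T) < 5n/9. -/

import Mathlib

open Finset

/-- `Contains G H` means `G` contains a subgraph isomorphic to `H`, i.e. there is an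
injective map on vertices preserving adjacency. -/
def Contains {α β : Type*} (G : SimpleGraph α) (H : SimpleGraph β) : Prop :=
  ∃ f : β → α, Function.Injective f ∧ ∀ ⦃u v⦄, H.Adj u v → G.Adj (f u) (f v)

/-- The fan `F_m = K_1 + mK_2`: a center vertex joined to `m` disjoint edges,
so `m` triangles sharing exactly one common vertex; it has `2m + 1` vertices. -/
def fan (m : ℕ) : SimpleGraph (Unit ⊕ Fin m × Bool) :=
  SimpleGraph.fromRel (fun x y =>
    (∃ u, x = Sum.inl u) ∨ ∃ i : Fin m, x = Sum.inr (i, true) ∧ y = Sum.inr (i, false))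

section Aux

open Classical in
/-- neighbours of `x` inside `S` -/
noncomputable def nb {W : Type*} (G : SimpleGraph W) (S : Finset W) (x : W) : Finset W :=
  S.filter (fun w => G.Adj x w)

open Classical in
/-- `S` contains a matching of size `j` -/
def hasM {W : Type*} (G : SimpleGraph W) : ℕ → Finset W → Prop
  | 0, _ => True
  | (j + 1), S => ∃ u ∈ S, ∃ v ∈ S, G.Adj u v ∧ hasM G j (S \ {u, v})

theorem mem_nb {W : Type*} {G : SimpleGraph W} {S : Finset W} {x w : W} :
    w ∈ nb G S x ↔ w ∈ S ∧ G.Adj x w := by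
  simp [nb]

theorem hasM_mono {W : Type*} (G : SimpleGraph W) (j : ℕ) :
    ∀ S S' : Finset W, S ⊆ S' → hasM G j S → hasM G j S' := by
  classical
  induction j with
  | zero => intro S S' _ _; trivial
  | succ j ih =>
    rintro S S' h ⟨u, hu, v, hv, ha, hm⟩
    refine ⟨u, h hu, v, h hv, ha, ih _ _ ?_ hm⟩
    convert Finset.sdiff_subset_sdiff h (le_refl _)

theorem hasM_fun {W : Type*} (G : SimpleGraph W) (j : ℕ) :
    ∀ S : Finset W, hasM G j S → ∃ f : Fin j × Bool → W, Function.Injective f ∧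
      (∀ p, f p ∈ S) ∧ ∀ i, G.Adj (f (i, true)) (f (i, false)) := by
  classical
  induction j with
  | zero =>
    intro S _
    exact ⟨fun p => p.1.elim0, fun p => p.1.elim0, fun p => p.1.elim0, fun i => i.elim0⟩
  | succ j ih =>
    rintro S ⟨u, hu, v, hv, ha, hm⟩
    obtain ⟨f, hf, hfS, hfa⟩ := ih _ hm
    have hfS' : ∀ p, f p ∈ S ∧ f p ≠ u ∧ f p ≠ v := by
      intro p
      have := hfS p
      simp at this
      tauto
    refine ⟨fun p => Fin.cases (if p.2 then u else v) (fun i => f (i, p.2)) p.1, ?_, ?_, ?_⟩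
    · rintro ⟨a, b⟩ ⟨c, d⟩ h
      have huv := ha.ne
      induction a using Fin.cases with
      | zero =>
        induction c using Fin.cases with
        | zero => cases b <;> cases d <;> simp_all
        | succ c =>
          exfalso
          obtain ⟨_, g1, g2⟩ := hfS' (c, d)
          cases b
          · exact g2 (by simpa using h.symm)
          · exact g1 (by simpa using h.symm)
      | succ a =>
        induction c using Fin.cases with
        | zero =>
          exfalso
          obtain ⟨_, g1, g2⟩ := hfS' (a, b)
          cases d
          · exact g2 (by simpa using h)
          · exact g1 (by simpa using h)
        | succ c =>
          have := hf (a₁ := (a, b)) (a₂ := (c, d)) (by simpa using h)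
          simp_all
    · rintro ⟨a, b⟩
      induction a using Fin.cases with
      | zero => cases b <;> simpa
      | succ a => simpa using (hfS' (a, b)).1
    · intro i
      induction i using Fin.cases with
      | zero => simpa
      | succ a => simpa using hfa a

theorem fan_of_hasM {W : Type*} [Fintype W] (G : SimpleGraph W) (m : ℕ) (x : W)
    (h : hasM G m (nb G univ x)) : Contains G (fan m) := by
  obtain ⟨f, hf, hfS, hfa⟩ := hasM_fun G m _ h
  have hx : ∀ p, G.Adj x (f p) := fun p => (mem_nb.1 (hfS p)).2
  refine ⟨Sum.elim (fun _ => x) f, ?_, ?_⟩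
  · rintro (a | a) (b | b) hab
    · rfl
    · exact absurd hab (hx b).ne
    · exact absurd hab (hx a).ne'
    · simpa using hf hab
  · rintro (a | a) (b | b) hab
    · simp [fan] at hab
    · exact hx b
    · exact (hx a).symm
    · simp only [fan, SimpleGraph.fromRel_adj] at hab
      obtain ⟨_, (h | ⟨i, h1, h2⟩) | (h | ⟨i, h1, h2⟩)⟩ := hab
      · simp at h
      · simp at h1 h2; subst h1 h2; exact hfa i
      · simp at h
      · simp at h1 h2; subst h1 h2; exact (hfa i).symm

open Classical in
/-- non-isolated vertices of `G[S]` -/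
noncomputable def ni {W : Type*} (G : SimpleGraph W) (S : Finset W) : Finset W :=
  S.filter (fun w => ∃ v ∈ S, G.Adj w v)

theorem hasM_of_ni {W : Type*} (G : SimpleGraph W) (m : ℕ) (hm : 1 ≤ m) (j : ℕ) :
    ∀ S : Finset W, (∀ u ∈ S, (nb G S u).card ≤ m - 1) → m * j < (ni G S).card + m →
      hasM G j S := by
  classical
  induction j with
  | zero => intros; trivial
  | succ j ih =>
    intro S hS hj
    have hpos : 0 < (ni G S).card := by
      rw [mul_add] at hj
      have := Nat.zero_le (m * j)
      omega
    have key : ∃ u ∈ S, ∃ v ∈ S, G.Adj u v ∧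
        ∀ w ∈ S, w ≠ u → w ≠ v → (∃ z ∈ S, G.Adj w z) →
          (∀ z ∈ S, G.Adj w z → z = u ∨ z = v) → G.Adj u w := by
      by_cases hl : ∃ v ∈ S, ∃ u ∈ S, G.Adj v u ∧ ∀ z ∈ S, G.Adj v z → z = u
      · obtain ⟨v, hv, u, hu, ha, hz⟩ := hl
        refine ⟨u, hu, v, hv, ha.symm, ?_⟩
        rintro w hw hwu hwv ⟨z, hzS, hwz⟩ hall
        rcases hall z hzS hwz with rfl | rfl
        · exact hwz.symm
        · exact absurd (hz w hw hwz.symm) hwu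
      · push Not at hl
        obtain ⟨u, hu⟩ := Finset.card_pos.1 hpos
        simp only [ni, Finset.mem_filter] at hu
        obtain ⟨hu, v, hv, ha⟩ := hu
        refine ⟨u, hu, v, hv, ha, ?_⟩
        rintro w hw hwu hwv ⟨z, hzS, hwz⟩ hall
        rcases hall z hzS hwz with rfl | rfl
        · exact hwz.symm
        · obtain ⟨z', hz', h1, h2⟩ := hl w hw z hzS hwz
          rcases hall z' hz' h1 with rfl | rfl
          · exact h1.symm
          · exact absurd rfl h2
    obtain ⟨u, hu, v, hv, ha, hk⟩ := key
    refine ⟨u, hu, v, hv, ha, ?_⟩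
    have : hasM G j (S \ {u, v}) := by
      apply ih
      · intro w hw
        refine le_trans (Finset.card_le_card ?_) (hS w (Finset.mem_sdiff.1 hw).1)
        intro z hz
        rw [mem_nb] at hz ⊢
        exact ⟨(Finset.mem_sdiff.1 hz.1).1, hz.2⟩
      · have hsub : ni G S ⊆ ni G (S \ {u, v}) ∪ insert u (nb G S u) := by
          intro w hw
          simp only [ni, Finset.mem_filter] at hw
          obtain ⟨hwS, hwz⟩ := hw
          by_cases h1 : w = u
          · simp [h1]
          by_cases h2 : w = v
          · subst h2; simp [mem_nb, hv, ha]
          by_cases h3 : ∀ z ∈ S, G.Adj w z → z = u ∨ z = v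
          · simp [mem_nb, hwS, hk w hwS h1 h2 hwz h3]
          · push Not at h3
            obtain ⟨z, hz, hz1, hz2⟩ := h3
            apply Finset.mem_union_left
            simp only [ni, Finset.mem_filter, Finset.mem_sdiff, Finset.mem_insert,
              Finset.mem_singleton]
            exact ⟨⟨hwS, by tauto⟩, z, ⟨hz, by tauto⟩, hz1⟩
        have h1 := Finset.card_le_card hsub
        have h2 := Finset.card_union_le (ni G (S \ {u, v})) (insert u (nb G S u))
        have h3 := Finset.card_insert_le u (nb G S u)
        have h4 := hS u hu
        rw [mul_add] at hj
        omega
    convert this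

theorem hasM_greedy0 {W : Type*} (G : SimpleGraph W) (q : ℕ) :
    ∀ Q P S : Finset W, Q.card = q → Q ⊆ S → P ⊆ S → Disjoint Q P →
      (∀ w ∈ Q, Q.card ≤ (nb G P w).card) → hasM G q S := by
  classical
  induction q with
  | zero => intros; trivial
  | succ q ih =>
    intro Q P S hq hQ hP hd hw
    obtain ⟨w, hwQ⟩ : Q.Nonempty := Finset.card_pos.1 (by omega)
    obtain ⟨p, hp⟩ : (nb G P w).Nonempty := Finset.card_pos.1 (by have := hw w hwQ; omega)
    rw [mem_nb] at hp
    refine ⟨w, hQ hwQ, p, hP hp.1, hp.2, ?_⟩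
    have hc : (Q.erase w).card = q := by rw [Finset.card_erase_of_mem hwQ]; omega
    have : hasM G q (S \ {w, p}) := by
      refine ih (Q.erase w) (P.erase p) _ hc ?_ ?_ ?_ ?_
      · intro z hz
        have hz' := Finset.mem_erase.1 hz
        have : z ≠ p := fun h => Finset.disjoint_left.1 hd hz'.2 (h ▸ hp.1)
        simp [hQ hz'.2, hz'.1, this]
      · intro z hz
        have hz' := Finset.mem_erase.1 hz
        have : z ≠ w := fun h => Finset.disjoint_left.1 hd hwQ (h ▸ hz'.2)
        simp [hP hz'.2, hz'.1, this]
      · exact (hd.mono_left (Finset.erase_subset _ _)).mono_right (Finset.erase_subset _ _)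
      · intro z hz
        have h1 := hw z (Finset.mem_of_mem_erase hz)
        have h2 : nb G (P.erase p) z = (nb G P z).erase p := by
          ext t; simp [mem_nb, and_assoc]
        rw [h2]
        have := Finset.pred_card_le_card_erase (s := nb G P z) (a := p)
        omega
    convert this

theorem hasM_greedy {W : Type*} (G : SimpleGraph W) (j : ℕ) :
    ∀ Q P S : Finset W, Q ⊆ S → P ⊆ S → Disjoint Q P →
      (∀ w ∈ Q, Q.card + 2 * j ≤ (nb G P w).card) → hasM G j P → hasM G (Q.card + j) S := by
  classical
  induction j with
  | zero =>
    intro Q P S h1 h2 h3 h4 _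
    exact hasM_greedy0 G _ Q P S rfl h1 h2 h3 (by simpa using h4)
  | succ j ih =>
    rintro Q P S h1 h2 h3 h4 ⟨u, hu, v, hv, ha, hm⟩
    refine ⟨u, h2 hu, v, h2 hv, ha, ?_⟩
    have hm' : hasM G j (P \ {u, v}) := by convert hm
    have : hasM G (Q.card + j) (S \ {u, v}) := by
      refine ih Q (P \ {u, v}) _ ?_ ?_ ?_ ?_ hm'
      · intro z hz
        have a1 : z ≠ u := fun h => Finset.disjoint_left.1 h3 hz (h ▸ hu)
        have a2 : z ≠ v := fun h => Finset.disjoint_left.1 h3 hz (h ▸ hv)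
        simp [h1 hz, a1, a2]
      · exact Finset.sdiff_subset_sdiff h2 (le_refl _)
      · exact h3.mono_right Finset.sdiff_subset
      · intro z hz
        have e1 := h4 z hz
        have e2 : nb G (P \ {u, v}) z = (nb G P z) \ {u, v} := by
          ext t; simp [mem_nb]; tauto
        rw [e2]
        have e3 := Finset.le_card_sdiff {u, v} (nb G P z)
        have e4 : ({u, v} : Finset W).card ≤ 2 := Finset.card_le_two
        omega
    show hasM G (Q.card + j) _
    convert this

theorem nb_card_add {W : Type*} (G : SimpleGraph W) [Fintype W] (X Y : Finset W)
    (hd : Disjoint X Y) (hu : ∀ w, w ∈ X ∨ w ∈ Y) (x : W) :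
    (nb G X x).card + (nb G Y x).card = (nb G univ x).card := by
  classical
  rw [← Finset.card_union_of_disjoint]
  · congr 1; ext w; simp only [Finset.mem_union, mem_nb, Finset.mem_univ, true_and]
    have := hu w; tauto
  · rw [Finset.disjoint_left]; intro a h1 h2
    exact Finset.disjoint_left.1 hd (mem_nb.1 h1).1 (mem_nb.1 h2).1

theorem nb_inter {W : Type*} (G : SimpleGraph W) (P X : Finset W) (hP : P ⊆ X) (w : W) :
    (nb G X w).card + P.card ≤ (nb G P w).card + X.card := by
  classical
  have h : nb G X w ⊆ nb G P w ∪ (X \ P) := by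
    intro z hz
    rw [mem_nb] at hz
    by_cases h : z ∈ P
    · simp [mem_nb, h, hz.2]
    · simp [h, hz.1]
  have h1 := Finset.card_le_card h
  have h2 := Finset.card_union_le (nb G P w) (X \ P)
  have h3 := Finset.card_sdiff_add_card_eq_card hP
  omega

theorem half {W : Type*} [Fintype W] (G : SimpleGraph W) (m n : ℕ) (hm : 18 ≤ m)
    (hn : m * (m - 1) + 1 ≤ n) (hW : Fintype.card W = 2 * n - 1)
    (hno : ∀ x, ¬ hasM G m (nb G univ x))
    (hdeg : ∀ x, n ≤ (nb G univ x).card)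
    (X Y : Finset W) (hd : Disjoint X Y) (hu : ∀ w, w ∈ X ∨ w ∈ Y)
    (hX : ∀ x ∈ X, (nb G X x).card ≤ m - 1) (hY : ∀ x ∈ Y, (nb G Y x).card ≤ m - 1)
    (hXc : n ≤ X.card) (hYne : Y.Nonempty) : False := by
  classical
  have hXY : X.card + Y.card = 2 * n - 1 := by
    rw [← hW, ← Finset.card_union_of_disjoint hd, ← Finset.card_univ]
    congr 1; ext w; simpa using hu w
  have hn17 : 17 * m + 1 ≤ n := by
    have : m * 17 ≤ m * (m - 1) := Nat.mul_le_mul_left _ (by omega)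
    omega
  obtain ⟨k, hk⟩ : ∃ k, k + Y.card = n := ⟨n - Y.card, by omega⟩
  have hk1 : 1 ≤ k := by omega
  have hXk : ∀ x ∈ X, k ≤ (nb G X x).card := by
    intro x _
    have h1 := nb_card_add G X Y hd hu x
    have h2 := hdeg x
    have h3 : (nb G Y x).card ≤ Y.card := Finset.card_le_card (fun z hz => (mem_nb.1 hz).1)
    omega
  have hkm : k ≤ m - 1 := by
    obtain ⟨x, hx⟩ : X.Nonempty := Finset.card_pos.1 (by omega)
    exact (hXk x hx).trans (hX x hx)
  obtain ⟨y, hy⟩ := hYne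
  set P := nb G X y with hPdef
  set Q := nb G Y y with hQdef
  have hq : Q.card ≤ m - 1 := hY y hy
  have hPX : P ⊆ X := fun z hz => (mem_nb.1 hz).1
  have hPQ : n ≤ P.card + Q.card := by rw [nb_card_add G X Y hd hu y]; exact hdeg y
  have hnoM : ¬ hasM G (m - Q.card) P := by
    intro hM
    apply hno y
    have := hasM_greedy G (m - Q.card) Q P (nb G univ y) ?_ ?_ ?_ ?_ hM
    · rwa [Nat.add_sub_cancel' (by omega)] at this
    · intro z hz; simp [mem_nb, (mem_nb.1 hz).2]
    · intro z hz; simp [mem_nb, (mem_nb.1 hz).2]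
    · exact (hd.symm.mono_left (fun z hz => (mem_nb.1 hz).1)).mono_right hPX
    · intro w hw
      have h0 := hY w (mem_nb.1 hw).1
      have h1 := nb_card_add G X Y hd hu w
      have h2 := hdeg w
      have h3 := nb_inter G P X hPX w
      omega
  have hni : (ni G P).card + m ≤ m * (m - Q.card) := by
    by_contra hcon
    apply hnoM
    refine hasM_of_ni G m (by omega) _ P ?_ (by omega)
    intro u hu'
    refine le_trans (Finset.card_le_card ?_) (hX u (hPX hu'))
    intro z hz
    rw [mem_nb] at hz ⊢
    exact ⟨hPX hz.1, hz.2⟩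
  have hniP : ni G P ⊆ P := Finset.filter_subset _ _
  set I := P \ ni G P with hI
  have hIc : I.card + (ni G P).card = P.card := Finset.card_sdiff_add_card_eq_card hniP
  set D := X \ P with hD
  have hDc : D.card + P.card = X.card := Finset.card_sdiff_add_card_eq_card hPX
  have hID : ∀ x ∈ I, k ≤ (nb G D x).card := by
    intro x hx
    rw [hI, Finset.mem_sdiff] at hx
    refine (hXk x (hPX hx.1)).trans (Finset.card_le_card ?_)
    intro z hz
    rw [mem_nb] at hz ⊢
    refine ⟨?_, hz.2⟩
    rw [hD, Finset.mem_sdiff]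
    refine ⟨hz.1, fun hzP => hx.2 ?_⟩
    simp only [ni, Finset.mem_filter]
    exact ⟨hx.1, z, hzP, hz.2⟩
  have hDI : ∀ x ∈ D, (nb G I x).card ≤ m - 1 := by
    intro x hx
    refine le_trans (Finset.card_le_card ?_) (hX x (Finset.mem_sdiff.1 hx).1)
    intro z hz
    rw [mem_nb] at hz ⊢
    exact ⟨hPX (Finset.mem_sdiff.1 hz.1).1, hz.2⟩
  have hcount : I.card * k ≤ D.card * (m - 1) := by
    refine Finset.card_mul_le_card_mul (fun a b => G.Adj a b) ?_ ?_
    · intro a ha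
      have he : bipartiteAbove (fun a b => G.Adj a b) D a = nb G D a := by
        ext z; simp [mem_nb, Finset.mem_bipartiteAbove]
      rw [he]
      exact hID a ha
    · intro b hb
      refine le_trans (le_of_eq ?_) (hDI b hb)
      congr 1; ext z; simp [mem_nb, Finset.mem_bipartiteBelow, G.adj_comm]
  obtain ⟨q, hqe⟩ : ∃ q, Q.card = q := ⟨_, rfl⟩
  rw [hqe] at hq hPQ hni
  obtain ⟨M, rfl⟩ : ∃ M, m = M + 1 := ⟨m - 1, by omega⟩
  obtain ⟨c, hc⟩ : ∃ c, q + c = M := ⟨M - q, by omega⟩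
  have e1 : M + 1 - q = c + 1 := by omega
  rw [e1] at hni
  simp only [Nat.add_sub_cancel] at *
  have hnic : (ni G P).card ≤ (M + 1) * c := by nlinarith
  -- isolated vertices are numerous
  have hIq : 1 + M * q ≤ I.card := by
    subst hc
    nlinarith
  have hDq : D.card + 1 ≤ k + q := by omega
  rcases Nat.eq_zero_or_pos q with h0 | h0
  · obtain ⟨x, hx⟩ : I.Nonempty := Finset.card_pos.1 (by omega)
    have h1 := hID x hx
    have h2 : (nb G D x).card ≤ D.card := Finset.card_le_card (fun z hz => (mem_nb.1 hz).1)
    omega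
  · obtain ⟨a, rfl⟩ : ∃ a, k = a + 1 := ⟨k - 1, by omega⟩
    obtain ⟨b, rfl⟩ : ∃ b, q = b + 1 := ⟨q - 1, by omega⟩
    have h1 : (1 + M * (b + 1)) * (a + 1) ≤ I.card * (a + 1) := Nat.mul_le_mul_right _ hIq
    have h2 : D.card * M ≤ (a + b + 1) * M := Nat.mul_le_mul_right _ (by omega)
    have h3 : 0 ≤ M * (a * b) := Nat.zero_le _
    nlinarith

/-- If all relevant degrees are at least `n`, there is a large matching in a neighbourhood. -/
theorem core {W : Type*} [Fintype W] (G : SimpleGraph W) (m n : ℕ) (hm : 18 ≤ m)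
    (hn : m * (m - 1) + 1 ≤ n) (hW : Fintype.card W = 2 * n - 1)
    (hno : ∀ x, ¬ hasM G m (nb G univ x))
    (U1 U2 : Finset W) (hdisj : Disjoint U1 U2)
    (hind1 : ∀ a ∈ U1, ∀ b ∈ U1, ¬ G.Adj a b)
    (hind2 : ∀ a ∈ U2, ∀ b ∈ U2, ¬ G.Adj a b)
    (hc1 : n - 2 * m + 2 ≤ U1.card) (hc2 : n - 2 * m + 2 ≤ U2.card)
    (hdeg1 : ∀ r, (nb G U1 r).card < 3 * m → n ≤ (nb G univ r).card)
    (hdeg2 : ∀ r, (nb G U2 r).card < 3 * m → n ≤ (nb G univ r).card) : False := by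
  classical
  have hn17 : 17 * m + 1 ≤ n := by
    have : m * 17 ≤ m * (m - 1) := Nat.mul_le_mul_left _ (by omega)
    omega
  have hnb1 : ∀ a ∈ U1, (nb G U1 a).card = 0 := by
    intro a ha
    rw [Finset.card_eq_zero, Finset.eq_empty_iff_forall_notMem]
    intro z hz
    exact hind1 a ha z (mem_nb.1 hz).1 (mem_nb.1 hz).2
  have hnb2 : ∀ a ∈ U2, (nb G U2 a).card = 0 := by
    intro a ha
    rw [Finset.card_eq_zero, Finset.eq_empty_iff_forall_notMem]
    intro z hz
    exact hind2 a ha z (mem_nb.1 hz).1 (mem_nb.1 hz).2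
  have hcompl : ∀ S : Finset W, S.card + (univ \ S).card = 2 * n - 1 := by
    intro S
    have := Finset.card_sdiff_add_card_eq_card (Finset.subset_univ S)
    rw [Finset.card_univ, hW] at this
    omega
  have hsplit : ∀ (S : Finset W) (x : W),
      (nb G S x).card + (nb G (univ \ S) x).card = (nb G univ x).card := by
    intro S x
    apply nb_card_add
    · exact Finset.disjoint_sdiff
    · intro w; simp; tauto
  -- vertices of `U1` see almost all of `U2`
  have hsee : ∀ x ∈ U1, ∀ P ⊆ U2, P.card ≤ (nb G P x).card + 2 * m := by
    intro x hx P hP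
    have h1 := hsplit U1 x
    have h2 := hcompl U1
    have h3 := hdeg1 x (by rw [hnb1 x hx]; omega)
    have h4 := nb_inter G P (univ \ U1) (fun z hz => by
      simp only [Finset.mem_sdiff, Finset.mem_univ, true_and]
      exact fun h => Finset.disjoint_left.1 hdisj h (hP hz)) x
    rw [hnb1 x hx] at h1
    omega
  have hor : ∀ r, (nb G U1 r).card < 3 * m ∨ (nb G U2 r).card < 3 * m := by
    intro r
    by_contra hcon
    push Not at hcon
    obtain ⟨Q, hQ, hQc⟩ := Finset.exists_subset_card_eq (show m ≤ (nb G U1 r).card by omega)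
    apply hno r
    refine hasM_greedy0 G m Q (nb G U2 r) _ hQc ?_ ?_ ?_ ?_
    · intro z hz; simp [mem_nb, (mem_nb.1 (hQ hz)).2]
    · intro z hz; simp [mem_nb, (mem_nb.1 hz).2]
    · exact (hdisj.mono_left (fun z hz => (mem_nb.1 (hQ hz)).1)).mono_right
        (fun z hz => (mem_nb.1 hz).1)
    · intro w hw
      have := hsee w (mem_nb.1 (hQ hw)).1 (nb G U2 r) (fun z hz => (mem_nb.1 hz).1)
      omega
  have hdeg : ∀ r, n ≤ (nb G univ r).card := fun r => (hor r).elim (hdeg1 r) (hdeg2 r)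
  have hmain : ∀ A B : Finset W, Disjoint A B → n - 2 * m + 2 ≤ A.card →
      n - 2 * m + 2 ≤ B.card → (∀ a ∈ B, (nb G B a).card = 0) →
      ∀ z, (nb G A z).card < 3 * m → B.card ≤ (nb G B z).card + 7 * m - 5 := by
    intro A B hAB hA hB hB0 z hz
    have hBn : B.card ≤ n - 1 := by
      obtain ⟨b, hb⟩ : B.Nonempty := Finset.card_pos.1 (by omega)
      have h1 := hsplit B b
      have h2 := hcompl B
      have h3 : (nb G (univ \ B) b).card ≤ (univ \ B).card :=
        Finset.card_le_card (fun z hz => (mem_nb.1 hz).1)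
      have h4 := hdeg b
      rw [hB0 b hb] at h1
      omega
    have h1 := hsplit (A ∪ B) z
    have h2 := hcompl (A ∪ B)
    have h3 : (nb G (univ \ (A ∪ B)) z).card ≤ (univ \ (A ∪ B)).card :=
        Finset.card_le_card (fun z hz => (mem_nb.1 hz).1)
    have h4 := hdeg z
    have h5 : nb G (A ∪ B) z = nb G A z ∪ nb G B z := by
      ext t; simp [mem_nb]; tauto
    have h6 := Finset.card_union_le (nb G A z) (nb G B z)
    rw [Finset.card_union_of_disjoint hAB] at h2
    rw [h5] at h1
    omega
  have hcl : ∀ (B X : Finset W), n - 2 * m + 2 ≤ B.card → Disjoint X B →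
      (∀ z ∈ X, B.card ≤ (nb G B z).card + 7 * m - 5) → ∀ z ∈ X, (nb G X z).card ≤ m - 1 := by
    intro B X hB hXB hXz z hz
    by_contra hcon
    obtain ⟨Q, hQ, hQc⟩ := Finset.exists_subset_card_eq (show m ≤ (nb G X z).card by omega)
    apply hno z
    refine hasM_greedy0 G m Q (nb G B z) _ hQc ?_ ?_ ?_ ?_
    · intro z hz; simp [mem_nb, (mem_nb.1 (hQ hz)).2]
    · intro z hz; simp [mem_nb, (mem_nb.1 hz).2]
    · exact (hXB.mono_left (fun z hz => (mem_nb.1 (hQ hz)).1)).mono_right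
        (fun z hz => (mem_nb.1 hz).1)
    · intro w hw
      have h1 := hXz w (mem_nb.1 (hQ hw)).1
      have h2 := hXz z hz
      have h3 := nb_inter G (nb G B z) B (fun z hz => (mem_nb.1 hz).1) w
      omega
  set X := univ.filter (fun r => (nb G U1 r).card < 3 * m) with hX
  set Y := univ.filter (fun r => ¬ (nb G U1 r).card < 3 * m) with hY
  have hXz : ∀ z ∈ X, U2.card ≤ (nb G U2 z).card + 7 * m - 5 := by
    intro z hz
    simp only [hX, Finset.mem_filter] at hz
    exact hmain U1 U2 hdisj hc1 hc2 hnb2 z hz.2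
  have hYz : ∀ z ∈ Y, U1.card ≤ (nb G U1 z).card + 7 * m - 5 := by
    intro z hz
    simp only [hY, Finset.mem_filter] at hz
    exact hmain U2 U1 hdisj.symm hc2 hc1 hnb1 z ((hor z).resolve_left hz.2)
  have hXU : Disjoint X U2 := by
    rw [Finset.disjoint_left]
    intro z hz hz2
    have h1 := hXz z hz
    rw [hnb2 z hz2] at h1
    omega
  have hYU : Disjoint Y U1 := by
    rw [Finset.disjoint_left]
    intro z hz hz2
    have h1 := hYz z hz
    rw [hnb1 z hz2] at h1
    omega
  have hd : Disjoint X Y := by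
    rw [Finset.disjoint_left]
    intro z h1 h2
    simp only [hX, hY, Finset.mem_filter] at h1 h2
    exact h2.2 h1.2
  have hu : ∀ w, w ∈ X ∨ w ∈ Y := by
    intro w
    simp only [hX, hY, Finset.mem_filter, Finset.mem_univ, true_and]
    tauto
  have hX' := hcl U2 X hc2 hXU hXz
  have hY' := hcl U1 Y hc1 hYU hYz
  have hXY : X.card + Y.card = 2 * n - 1 := by
    rw [← hW, ← Finset.card_union_of_disjoint hd, ← Finset.card_univ]
    congr 1; ext w; simpa using hu w
  have hXne : X.Nonempty := by
    obtain ⟨b, hb⟩ : U1.Nonempty := Finset.card_pos.1 (by omega)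
    exact ⟨b, (hu b).resolve_right (fun h => Finset.disjoint_left.1 hYU h hb)⟩
  have hYne : Y.Nonempty := by
    obtain ⟨b, hb⟩ : U2.Nonempty := Finset.card_pos.1 (by omega)
    exact ⟨b, (hu b).resolve_left (fun h => Finset.disjoint_left.1 hXU h hb)⟩
  rcases le_total n X.card with h | h
  · exact half G m n hm hn hW hno hdeg X Y hd hu hX' hY' h hYne
  · by_cases h' : n ≤ Y.card
    · exact half G m n hm hn hW hno hdeg Y X hd.symm (fun w => (hu w).symm) hY' hX' h' hXne
    · exact half G m n hm hn hW hno hdeg X Y hd hu hX' hY' (by omega) hYne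

theorem exists_inj {V W : Type*} [Nonempty W] (s : Finset V) (t : Finset W)
    (h : s.card ≤ t.card) : ∃ f : V → W, Set.InjOn f s ∧ ∀ a ∈ s, f a ∈ t := by
  classical
  obtain ⟨t', ht', hc⟩ := Finset.exists_subset_card_eq h
  let e := Finset.equivOfCardEq hc.symm
  refine ⟨fun a => if h : a ∈ s then (e ⟨a, h⟩ : W) else Classical.arbitrary W, ?_, ?_⟩
  · intro a ha b hb hab
    have ha' : a ∈ s := ha
    have hb' : b ∈ s := hb
    simp only [ha', hb', dif_pos] at hab
    have := e.injective (Subtype.ext hab)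
    simpa using this
  · intro a ha
    simp only [ha, dif_pos]
    exact ht' (e ⟨a, ha⟩).2

/-- Embedding `U` with `v` placed at `r`, the leaves in `L` anywhere, the rest in `S`. -/
theorem embed {V W : Type*} [Fintype V] [Fintype W] (U : SimpleGraph V) (G : SimpleGraph W)
    (n : ℕ) (hV : Fintype.card V = n) (v : V) (L K : Finset V)
    (hL : ∀ a ∈ L, ∀ b, U.Adj a b → b = v) (hvL : v ∉ L)
    (hK : ∀ b, U.Adj v b → b ∉ L → b ∈ K) (hvK : v ∉ K) (hKL : Disjoint K L)
    (r : W) (S S0 : Finset W) (hrS : r ∉ S) (hS0 : S0 ⊆ S)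
    (hind : ∀ a ∈ S, ∀ b ∈ S, ¬ G.Adj a b) (hr0 : ∀ a ∈ S0, ¬ G.Adj r a)
    (hKc : K.card ≤ S0.card) (hSc : n ≤ S.card + L.card + 1)
    (C : Finset W) (hC : ∀ a ∈ C, a ≠ r ∧ ¬ G.Adj r a) (hCc : n ≤ C.card + 1) :
    Contains Gᶜ U := by
  classical
  have : Nonempty W := ⟨r⟩
  obtain ⟨f1, hf1, hf1S⟩ := exists_inj K S0 hKc
  set H := univ \ (insert v (L ∪ K)) with hH
  have hHc : H.card + (1 + (L.card + K.card)) = n := by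
    have : H.card + (insert v (L ∪ K)).card = (univ : Finset V).card :=
      Finset.card_sdiff_add_card_eq_card (Finset.subset_univ (insert v (L ∪ K)))
    rw [Finset.card_univ, hV, Finset.card_insert_of_notMem (by simp [hvL, hvK]),
      Finset.card_union_of_disjoint hKL.symm] at this
    omega
  have hi1 : (K.image f1).card = K.card := Finset.card_image_of_injOn hf1
  obtain ⟨f2, hf2, hf2S⟩ := exists_inj H (S \ K.image f1) (by
    have := Finset.le_card_sdiff (K.image f1) S
    omega)
  obtain ⟨f3, hf3, hf3S⟩ := exists_inj L (C \ (K.image f1 ∪ H.image f2)) (by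
    have := Finset.le_card_sdiff (K.image f1 ∪ H.image f2) C
    have h2 := Finset.card_union_le (K.image f1) (H.image f2)
    have h3 : (H.image f2).card ≤ H.card := Finset.card_image_le
    omega)
  have hcov : ∀ a, a = v ∨ a ∈ L ∨ a ∈ K ∨ a ∈ H := by
    intro a
    simp only [hH, Finset.mem_sdiff, Finset.mem_univ, true_and, Finset.mem_insert,
      Finset.mem_union]
    tauto
  have hHn : ∀ a ∈ H, a ≠ v ∧ a ∉ L ∧ a ∉ K := by
    intro a ha
    simp only [hH, Finset.mem_sdiff, Finset.mem_univ, true_and, Finset.mem_insert,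
      Finset.mem_union] at ha
    tauto
  let f : V → W := fun a => if a = v then r else if a ∈ L then f3 a else if a ∈ K then f1 a
    else f2 a
  have fv : f v = r := by simp [f]
  have fL : ∀ a ∈ L, f a = f3 a := by
    intro a ha
    have : a ≠ v := fun h => hvL (h ▸ ha)
    simp [f, this, ha]
  have fK : ∀ a ∈ K, f a = f1 a := by
    intro a ha
    have h1 : a ≠ v := fun h => hvK (h ▸ ha)
    have h2 : a ∉ L := Finset.disjoint_left.1 hKL ha
    simp [f, h1, h2, ha]
  have fH : ∀ a ∈ H, f a = f2 a := by
    intro a ha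
    obtain ⟨h1, h2, h3⟩ := hHn a ha
    simp [f, h1, h2, h3]
  have gL : ∀ a ∈ L, f a ≠ r ∧ ¬ G.Adj r (f a) := by
    intro a ha
    rw [fL a ha]
    exact hC _ (Finset.mem_sdiff.1 (hf3S a ha)).1
  have gK : ∀ a ∈ K, f a ∈ S ∧ ¬ G.Adj r (f a) := by
    intro a ha
    rw [fK a ha]
    exact ⟨hS0 (hf1S a ha), hr0 _ (hf1S a ha)⟩
  have gH : ∀ a ∈ H, f a ∈ S := by
    intro a ha
    rw [fH a ha]
    exact (Finset.mem_sdiff.1 (hf2S a ha)).1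
  have gne : ∀ a, a ≠ v → f a ≠ r := by
    intro a ha
    rcases hcov a with h | h | h | h
    · exact absurd h ha
    · exact (gL a h).1
    · exact fun e => hrS (e ▸ (gK a h).1)
    · exact fun e => hrS (e ▸ gH a h)
  have LK : ∀ a ∈ L, ∀ b ∈ K, f a ≠ f b := by
    intro a ha b hb e
    rw [fL a ha, fK b hb] at e
    have := (Finset.mem_sdiff.1 (hf3S a ha)).2
    rw [e] at this
    exact this (Finset.mem_union_left _ (Finset.mem_image_of_mem _ hb))
  have LH : ∀ a ∈ L, ∀ b ∈ H, f a ≠ f b := by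
    intro a ha b hb e
    rw [fL a ha, fH b hb] at e
    have := (Finset.mem_sdiff.1 (hf3S a ha)).2
    rw [e] at this
    exact this (Finset.mem_union_right _ (Finset.mem_image_of_mem _ hb))
  have HK : ∀ a ∈ H, ∀ b ∈ K, f a ≠ f b := by
    intro a ha b hb e
    rw [fH a ha, fK b hb] at e
    have := (Finset.mem_sdiff.1 (hf2S a ha)).2
    rw [e] at this
    exact this (Finset.mem_image_of_mem _ hb)
  have finj : Function.Injective f := by
    intro a b hab
    by_cases hav : a = v
    · by_contra hne
      exact gne b (fun h => hne (hav.trans h.symm)) (by rw [← hab, hav, fv])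
    by_cases hbv : b = v
    · exact absurd (by rw [hab, hbv, fv]) (gne a hav)
    rcases (hcov a).resolve_left hav with h | h | h <;>
      rcases (hcov b).resolve_left hbv with h' | h' | h'
    · exact hf3 h h' (by rw [← fL a h, ← fL b h', hab])
    · exact absurd hab (LK a h b h')
    · exact absurd hab (LH a h b h')
    · exact absurd hab.symm (LK b h' a h)
    · exact hf1 h h' (by rw [← fK a h, ← fK b h', hab])
    · exact absurd hab.symm (HK b h' a h)
    · exact absurd hab.symm (LH b h' a h)
    · exact absurd hab (HK a h b h')
    · exact hf2 h h' (by rw [← fH a h, ← fH b h', hab])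
  have hvadj : ∀ b, U.Adj v b → ¬ G.Adj r (f b) := by
    intro b hb
    by_cases hbL : b ∈ L
    · exact (gL b hbL).2
    · exact (gK b (hK b hb hbL)).2
  refine ⟨f, finj, ?_⟩
  intro a b hab
  rw [SimpleGraph.compl_adj]
  refine ⟨fun e => hab.ne (finj e), ?_⟩
  by_cases hav : a = v
  · subst hav; rw [fv]; exact hvadj b hab
  by_cases hbv : b = v
  · subst hbv; rw [fv, G.adj_comm]; exact hvadj a hab.symm
  have haS : ∀ a b, U.Adj a b → a ≠ v → b ≠ v → f a ∈ S := by
    intro a b hab hav hbv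
    rcases (hcov a).resolve_left hav with h | h | h
    · exact absurd (hL a h b hab) hbv
    · exact (gK a h).1
    · exact gH a h
  exact hind _ (haS a b hab hav hbv) _ (haS b a hab.symm hbv hav)

/-- In a tree, `deg v` plus the number of non-leaf neighbours of `v` is at most `n - 1`. -/
theorem tree_bound {V : Type*} [Fintype V] [DecidableEq V] (T : SimpleGraph V)
    [DecidableRel T.Adj] (hT : T.IsTree) (n : ℕ) (hV : Fintype.card V = n) (hn : 2 ≤ n) (v : V) :
    T.degree v + ((T.neighborFinset v).filter (fun u => ¬ T.degree u = 1)).card + 1 ≤ n := by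
  have h1 := T.sum_degrees_eq_twice_card_edges
  have h2 := hT.card_edgeFinset
  have : Nontrivial V := Fintype.one_lt_card_iff_nontrivial.1 (by omega)
  have hpos : ∀ w, 1 ≤ T.degree w := fun w => hT.connected.preconnected.degree_pos_of_nontrivial w
  have h3 : ∑ w, T.degree w = T.degree v + ∑ w ∈ univ.erase v, T.degree w :=
    (Finset.add_sum_erase univ (fun w => T.degree w) (Finset.mem_univ v)).symm
  set B := (T.neighborFinset v).filter (fun u => ¬ T.degree u = 1) with hB
  have hBs : B ⊆ univ.erase v := by
    intro w hw
    simp only [hB, Finset.mem_filter, SimpleGraph.mem_neighborFinset] at hw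
    simp [hw.1.ne']
  have h4 : ∑ w ∈ univ.erase v, (1 + if w ∈ B then 1 else 0) ≤ ∑ w ∈ univ.erase v, T.degree w := by
    apply Finset.sum_le_sum
    intro w _
    have := hpos w
    split_ifs with h
    · simp only [hB, Finset.mem_filter] at h
      omega
    · omega
  rw [Finset.sum_add_distrib, Finset.sum_ite_mem, Finset.inter_eq_right.2 hBs] at h4
  simp only [Finset.sum_const, smul_eq_mul, mul_one, Finset.card_erase_of_mem (Finset.mem_univ v),
    Finset.card_univ] at h4
  omega

end Aux

/-- **Claim 4.4**: with `U` unicyclic (not a cycle), `t₁t₂` an edge of its unique cycle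
(i.e. an edge whose deletion leaves a tree `T`) with `t₁` not a leaf of `T`, and `G` on
`2n - 1` vertices with no `F_m`, `Ḡ` with no `U`, and disjoint independent sets `U₁, U₂`
of size at least `n - 2m + 2`: every vertex of `T` is adjacent in `T` to at most `2m - 2`
leaves of `T`, and `Δ(T) < 5n/9`. -/
theorem unicyclic_tree_few_leaves_and_maxDegree
    {V W : Type*} [Fintype V] [Fintype W] [DecidableEq V]
    (m n : ℕ) (hm : 18 ≤ m) (hn : m ^ 2 - m + 1 ≤ n)
    (U : SimpleGraph V) (hUconn : U.Connected) (hUcard : Fintype.card V = n)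
    (hUedges : U.edgeSet.ncard = n)
    (hnotcycle : ¬ Nonempty (U ≃g SimpleGraph.cycleGraph n))
    (t1 t2 : V) (ht : U.Adj t1 t2)
    (T : SimpleGraph V) [DecidableRel T.Adj] (hTdef : T = U.deleteEdges {s(t1, t2)})
    (hTtree : T.IsTree) (ht1 : T.degree t1 ≠ 1)
    (G : SimpleGraph W) (hGcard : Fintype.card W = 2 * n - 1)
    (hnoF : ¬ Contains G (fan m)) (hnoU : ¬ Contains Gᶜ U)
    (U1 U2 : Finset W) (hdisj : Disjoint U1 U2)
    (hind1 : ∀ a ∈ U1, ∀ b ∈ U1, ¬ G.Adj a b)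
    (hind2 : ∀ a ∈ U2, ∀ b ∈ U2, ¬ G.Adj a b)
    (hc1 : n - 2 * m + 2 ≤ U1.card) (hc2 : n - 2 * m + 2 ≤ U2.card) :
    (∀ v : V, ((T.neighborFinset v).filter (fun u => T.degree u = 1)).card ≤ 2 * m - 2) ∧
      9 * T.maxDegree < 5 * n := by
  classical
  have hsq : m ^ 2 - m = m * (m - 1) := by
    rw [pow_two, Nat.mul_sub, mul_one]
  have hn' : m * (m - 1) + 1 ≤ n := by rw [← hsq]; exact hn
  have hn17 : 17 * m + 1 ≤ n := by
    have : m * 17 ≤ m * (m - 1) := Nat.mul_le_mul_left _ (by omega)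
    omega
  have hbound := tree_bound T hTtree n hUcard (by omega)
  have hsplit : ∀ v, ((T.neighborFinset v).filter (fun u => T.degree u = 1)).card +
      ((T.neighborFinset v).filter (fun u => ¬ T.degree u = 1)).card = T.degree v := by
    intro v
    rw [Finset.card_filter_add_card_filter_not, SimpleGraph.card_neighborFinset_eq_degree]
  have part1 : ∀ v : V,
      ((T.neighborFinset v).filter (fun u => T.degree u = 1)).card ≤ 2 * m - 2 := by
    intro v
    by_contra hcon
    have hb := hbound v
    have hs := hsplit v
    set A := (T.neighborFinset v).filter (fun u => T.degree u = 1) with hA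
    set B := (T.neighborFinset v).filter (fun u => ¬ T.degree u = 1) with hB
    have hTU : ∀ a b, T.Adj a b ↔ U.Adj a b ∧ s(a, b) ≠ s(t1, t2) := by
      intro a b
      rw [hTdef, SimpleGraph.deleteEdges_adj]
      simp
    set L := A.erase t2 with hL
    have hLc : 2 * m - 2 ≤ L.card := by
      have : A.card - 1 ≤ L.card := Finset.pred_card_le_card_erase
      omega
    have hLmem : ∀ a, a ∈ L ↔ a ≠ t2 ∧ T.Adj v a ∧ T.degree a = 1 := by
      intro a
      simp [hL, hA]
    set K := (nb U univ v) \ L with hK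
    have hKc : K.card ≤ B.card + 2 := by
      have hsub : K ⊆ B ∪ {t1, t2} := by
        intro w hw
        simp only [hK, Finset.mem_sdiff, mem_nb, Finset.mem_univ, true_and] at hw
        by_cases h1 : w = t1
        · simp [h1]
        by_cases h2 : w = t2
        · simp [h2]
        have hT : T.Adj v w := by
          rw [hTU]
          refine ⟨hw.1, ?_⟩
          intro h
          rw [Sym2.eq_iff] at h
          tauto
        apply Finset.mem_union_left
        simp only [hB, Finset.mem_filter, SimpleGraph.mem_neighborFinset]
        refine ⟨hT, fun hd => hw.2 ?_⟩
        rw [hLmem]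
        exact ⟨h2, hT, hd⟩
      have h1 := Finset.card_le_card hsub
      have h2 := Finset.card_union_le B {t1, t2}
      have h3 : ({t1, t2} : Finset V).card ≤ 2 := Finset.card_le_two
      omega
    have hemb : ∀ S : Finset W, (∀ a ∈ S, ∀ b ∈ S, ¬ G.Adj a b) → n - 2 * m + 2 ≤ S.card →
        ∀ r, (nb G S r).card < 3 * m → n ≤ (nb G univ r).card := by
      intro S hind hS r hr
      by_contra hdeg
      apply hnoU
      have herase := Finset.pred_card_le_card_erase (s := S) (a := r)
      refine embed U G n hUcard v L K ?_ ?_ ?_ ?_ ?_ r (S.erase r) (S.erase r \ nb G S r)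
        (by simp) Finset.sdiff_subset ?_ ?_ ?_ ?_ (univ.erase r \ nb G univ r) ?_ ?_
      · intro a ha b hab
        rw [hLmem] at ha
        obtain ⟨h1, h2, h3⟩ := ha
        have h4 : a ≠ t1 := fun h => ht1 (h ▸ h3)
        have h5 : T.Adj a b := by
          rw [hTU]
          refine ⟨hab, ?_⟩
          intro h
          rw [Sym2.eq_iff] at h
          tauto
        rw [← SimpleGraph.card_neighborFinset_eq_degree, Finset.card_eq_one] at h3
        obtain ⟨c, hc⟩ := h3
        have e1 : b ∈ T.neighborFinset a := by simpa using h5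
        have e2 : v ∈ T.neighborFinset a := by simpa using h2.symm
        rw [hc, Finset.mem_singleton] at e1 e2
        rw [e1, e2]
      · intro h
        rw [hLmem] at h
        exact h.2.1.ne rfl
      · intro b hb1 hb2
        simp [hK, mem_nb, hb1, hb2]
      · intro h
        simp [hK, mem_nb] at h
      · exact Finset.sdiff_disjoint
      · intro a ha b hb
        exact hind a (Finset.mem_of_mem_erase ha) b (Finset.mem_of_mem_erase hb)
      · intro a ha hra
        rw [Finset.mem_sdiff] at ha
        exact ha.2 (mem_nb.2 ⟨Finset.mem_of_mem_erase ha.1, hra⟩)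
      · have := Finset.le_card_sdiff (nb G S r) (S.erase r)
        omega
      · omega
      · intro a ha
        simp only [Finset.mem_sdiff, Finset.mem_erase, Finset.mem_univ, mem_nb, true_and,
          and_true] at ha
        exact ha
      · have h1 := Finset.le_card_sdiff (nb G univ r) (univ.erase r)
        rw [Finset.card_erase_of_mem (Finset.mem_univ r), Finset.card_univ, hGcard] at h1
        omega
    exact core G m n hm hn' hGcard (fun x hx => hnoF (fan_of_hasM G m x hx)) U1 U2 hdisj
      hind1 hind2 hc1 hc2 (hemb U1 hind1 hc1) (hemb U2 hind2 hc2)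
  refine ⟨part1, ?_⟩
  have : Nonempty V := ⟨t1⟩
  obtain ⟨v, hv⟩ := T.exists_maximal_degree_vertex
  rw [hv]
  by_contra hcon
  have h1 := hbound v
  have h2 := hsplit v
  have h3 := part1 v
  have h4 : 18 * m ≤ n + 26 := by
    rcases Nat.lt_or_ge 18 m with h | h
    · have : m * 18 ≤ m * (m - 1) := Nat.mul_le_mul_left _ (by omega)
      omega
    · have : m = 18 := by omega
      subst this
      omega
  omega
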